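/- arXiv:2106.06212 — 2 statements merged into one kernel-verified Lean document; each statement's English description precedes it below -/
import Mathlib

section
/- Let τ be a faithful positive tracial state on ℂ⟨X⟩, (P_w)_{w∈⟨X⟩_d} a family of orthonormal polynomials of τ at degree d, k ≥ 1, and A a tuple of hermitian k×k complex matrices. Then for every P ∈ M_k(ℂ⟨X⟩_d) such that the matrix (Id⊗τ)(PP⋆) is invertible, one has P(A)(I_k)^† ((Id⊗τ)(PP⋆))^{-1} P(A)(I_k) ⪯ κ_{τ,d}(A,A)(I_k). Consequently, κ_{τ,d}(A,A)(I_k) is the maximum, in the Loewner order, of the set {P(A)(I_k)^† P(A)(I_k) : P ∈ M_k(ℂ⟨X⟩_d), (Id⊗τ)(PP⋆) = I_k}: it dominates every member of this set, and equality is attained by some member. -/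
open scoped ComplexOrder Matrix

namespace NCCD

/-- Words in the letters `X_1, …, X_n`, i.e. elements of the free monoid on `n` generators. -/
abbrev Word (n : ℕ) : Type := FreeMonoid (Fin n)

/-- The free unital `*`-algebra `ℂ⟨X_1, …, X_n⟩`, modeled as the monoid algebra of the
free monoid on `n` generators. -/
abbrev NCPoly (n : ℕ) : Type := MonoidAlgebra ℂ (Word n)

/-- The monomial associated to a word. -/
noncomputable def mono {n : ℕ} (w : Word n) : NCPoly n :=
  MonoidAlgebra.of ℂ (Word n) w

/-- The length of a word. -/
def wlen {n : ℕ} (w : Word n) : ℕ := (FreeMonoid.toList w).length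

/-- The involution `⋆` on `ℂ⟨X⟩`: conjugate the coefficients and reverse the words. -/
noncomputable def ncStar {n : ℕ} (f : NCPoly n) : NCPoly n :=
  MonoidAlgebra.ofCoeff <| Finsupp.mapDomain (fun w => FreeMonoid.ofList (FreeMonoid.toList w).reverse)
    (Finsupp.mapRange (starRingEnd ℂ) (map_zero _) f.coeff)

/-- `τ` is a positive functional: `τ(f⋆ f) ≥ 0` for all `f`. -/
def IsPositive {n : ℕ} (τ : NCPoly n →ₗ[ℂ] ℂ) : Prop :=
  ∀ f : NCPoly n, 0 ≤ τ (ncStar f * f)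

/-- `τ` is tracial: `τ(fg) = τ(gf)`. -/
def IsTracial {n : ℕ} (τ : NCPoly n →ₗ[ℂ] ℂ) : Prop :=
  ∀ f g : NCPoly n, τ (f * g) = τ (g * f)

/-- `τ` is faithful: `τ(f⋆ f) = 0` implies `f = 0`. -/
def IsFaithful {n : ℕ} (τ : NCPoly n →ₗ[ℂ] ℂ) : Prop :=
  ∀ f : NCPoly n, τ (ncStar f * f) = 0 → f = 0

/-- The strict graded lexicographic order on words. -/
def glLt {n : ℕ} (v w : Word n) : Prop :=
  wlen v < wlen w ∨
    (wlen v = wlen w ∧ List.Lex (· < ·) (FreeMonoid.toList v) (FreeMonoid.toList w))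

/-- The graded lexicographic order on words. -/
def glLe {n : ℕ} (v w : Word n) : Prop := glLt v w ∨ v = w

/-- Words of length at most `d`. -/
abbrev WordLE (n d : ℕ) : Type := {w : Word n // wlen w ≤ d}

instance {n : ℕ} : DecidableEq (Word n) := fun a b =>
  decidable_of_iff (FreeMonoid.toList a = FreeMonoid.toList b)
    ⟨fun h => FreeMonoid.toList.injective h, fun h => by rw [h]⟩

instance (n d : ℕ) : Finite (WordLE n d) := by
  apply Finite.of_surjective
    (f := fun p : (k : Fin (d+1)) × (Fin k → Fin n) =>
      (⟨FreeMonoid.ofList (List.ofFn p.2), by simp [wlen]; omega⟩ : WordLE n d))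
  rintro ⟨w, hw⟩
  refine ⟨⟨⟨wlen w, by omega⟩, fun i => (FreeMonoid.toList w).get ⟨i, i.2⟩⟩, ?_⟩
  apply Subtype.ext
  simp [wlen, List.ofFn_get]

noncomputable instance (n d : ℕ) : Fintype (WordLE n d) := Fintype.ofFinite _

/-- The span `ℂ⟨X⟩_d` of the monomials of degree at most `d`. -/
noncomputable def degLE (n d : ℕ) : Submodule ℂ (NCPoly n) :=
  Submodule.span ℂ {p : NCPoly n | ∃ w : Word n, wlen w ≤ d ∧ p = mono w}

end NCCD

namespace NCCD

/-- A family of orthonormal polynomials of a faithful positive tracial state `τ` at degree `d`: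
a family `(P_w)` in `ℂ⟨X⟩_d` with `P_1 = 1`, `τ(P_v⋆ P_w) = δ_{v,w}`, `τ(P_v⋆ w) = 0` whenever
`w <_gl v`, and `τ(P_w⋆ w) > 0`, for all words `v, w` of length at most `d`. -/
def IsONB {n : ℕ} (τ : NCPoly n →ₗ[ℂ] ℂ) (d : ℕ) (P : Word n → NCPoly n) : Prop :=
  (∀ w : Word n, wlen w ≤ d → P w ∈ degLE n d) ∧
  P 1 = 1 ∧
  (∀ v w : Word n, wlen v ≤ d → wlen w ≤ d →
    τ (ncStar (P v) * P w) = if v = w then 1 else 0) ∧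
  (∀ v w : Word n, wlen v ≤ d → wlen w ≤ d → glLt w v → τ (ncStar (P v) * mono w) = 0) ∧
  (∀ w : Word n, wlen w ≤ d → 0 < τ (ncStar (P w) * mono w))

end NCCD

namespace NCCD

/-- Evaluation `A^w` of a word at a tuple of matrices. -/
noncomputable def wordEvalM {n k : ℕ} (A : Fin n → Matrix (Fin k) (Fin k) ℂ) (w : Word n) :
    Matrix (Fin k) (Fin k) ℂ :=
  ((FreeMonoid.toList w).map A).prod

/-- Evaluation `f(A)` of a noncommutative polynomial at a tuple of matrices. -/
noncomputable def polyEvalM {n k : ℕ} (A : Fin n → Matrix (Fin k) (Fin k) ℂ) (f : NCPoly n) :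
    Matrix (Fin k) (Fin k) ℂ :=
  Finsupp.sum f.coeff fun w c => c • wordEvalM A w

/-- `P(A)(I_k)` for the matrix noncommutative polynomial `P = Σ_i a_i ⊗ q_i`. -/
noncomputable def evalId {n k : ℕ} {ι : Type*} [Fintype ι]
    (A : Fin n → Matrix (Fin k) (Fin k) ℂ) (a : ι → Matrix (Fin k) (Fin k) ℂ)
    (q : ι → NCPoly n) : Matrix (Fin k) (Fin k) ℂ :=
  ∑ i, a i * polyEvalM A (q i)

/-- `(Id ⊗ τ)(P P⋆)` for the matrix noncommutative polynomial `P = Σ_i a_i ⊗ q_i`. -/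
noncomputable def idTensorTau {n k : ℕ} {ι : Type*} [Fintype ι] (τ : NCPoly n →ₗ[ℂ] ℂ)
    (a : ι → Matrix (Fin k) (Fin k) ℂ) (q : ι → NCPoly n) : Matrix (Fin k) (Fin k) ℂ :=
  ∑ i, ∑ j, τ (q i * ncStar (q j)) • (a i * (a j)ᴴ)

/-- The Christoffel–Darboux kernel evaluation
`κ_{τ,d}(A,A)(I_k) = Σ_w P_w(A) ⬝ (P_w⋆)(A)`. -/
noncomputable def cdKernel {n k : ℕ} (d : ℕ) (P : Word n → NCPoly n)
    (A : Fin n → Matrix (Fin k) (Fin k) ℂ) : Matrix (Fin k) (Fin k) ℂ :=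
  ∑ w : WordLE n d, polyEvalM A (P w.1) * polyEvalM A (ncStar (P w.1))

end NCCD

namespace NCCD

section helpers

lemma ncStar_add {n : ℕ} (f g : NCPoly n) : ncStar (f + g) = ncStar f + ncStar g := by
  simp only [ncStar, MonoidAlgebra.coeff_add]
  rw [Finsupp.mapRange_add (fun x y => map_add _ x y), Finsupp.mapDomain_add,
    MonoidAlgebra.ofCoeff_add]

lemma ncStar_zero {n : ℕ} : ncStar (0 : NCPoly n) = 0 := by
  simp [ncStar]

lemma ncStar_single {n : ℕ} (w : Word n) (a : ℂ) :
    ncStar (MonoidAlgebra.single w a) = MonoidAlgebra.single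
      (FreeMonoid.ofList (FreeMonoid.toList w).reverse) (starRingEnd ℂ a) := by
  simp [ncStar, Finsupp.mapDomain_single]

lemma ncStar_smul {n : ℕ} (a : ℂ) (f : NCPoly n) :
    ncStar (a • f) = (starRingEnd ℂ a) • ncStar f := by
  induction f using MonoidAlgebra.induction_linear with
  | zero => simp [ncStar_zero]
  | add f g hf hg => rw [smul_add, ncStar_add, hf, hg, ncStar_add, smul_add]
  | single w c => simp [ncStar_single, MonoidAlgebra.smul_single]

lemma ncStar_sum {n : ℕ} {ι : Type*} (s : Finset ι) (f : ι → NCPoly n) :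
    ncStar (∑ i ∈ s, f i) = ∑ i ∈ s, ncStar (f i) :=
  map_sum (⟨⟨ncStar, ncStar_zero⟩, ncStar_add⟩ : NCPoly n →+ NCPoly n) f s

lemma mono_eq {n : ℕ} (w : Word n) : mono w = MonoidAlgebra.single w (1 : ℂ) := rfl

lemma ncStar_mem {n d : ℕ} {f : NCPoly n} (hf : f ∈ degLE n d) : ncStar f ∈ degLE n d := by
  unfold degLE at hf
  induction hf using Submodule.span_induction with
  | mem x hx =>
    obtain ⟨w, hw, rfl⟩ := hx
    rw [mono_eq, ncStar_single, map_one]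
    exact Submodule.subset_span ⟨_, by simpa [wlen] using hw, rfl⟩
  | zero => rw [ncStar_zero]; exact Submodule.zero_mem _
  | add x y _ _ hx hy => rw [ncStar_add]; exact Submodule.add_mem _ hx hy
  | smul a x _ hx => rw [ncStar_smul]; exact Submodule.smul_mem _ _ hx

/-- evaluation as a linear map -/
noncomputable def evalL {n k : ℕ} (A : Fin n → Matrix (Fin k) (Fin k) ℂ) :
    NCPoly n →ₗ[ℂ] Matrix (Fin k) (Fin k) ℂ where
  toFun := polyEvalM A
  map_add' f g := by
    simp only [polyEvalM, MonoidAlgebra.coeff_add]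
    exact Finsupp.sum_add_index' (by simp) (by intros; rw [add_smul])
  map_smul' a f := by
    simp only [polyEvalM, MonoidAlgebra.coeff_smul, RingHom.id_apply]
    rw [Finsupp.sum_smul_index' (by simp), Finsupp.smul_sum]
    simp only [smul_assoc]

lemma evalL_apply {n k : ℕ} (A : Fin n → Matrix (Fin k) (Fin k) ℂ) (f : NCPoly n) :
    polyEvalM A f = evalL A f := rfl

lemma polyEvalM_single {n k : ℕ} (A : Fin n → Matrix (Fin k) (Fin k) ℂ) (w : Word n) (a : ℂ) :
    polyEvalM A (MonoidAlgebra.single w a) = a • wordEvalM A w := by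
  simp [polyEvalM]

lemma polyEvalM_one {n k : ℕ} (A : Fin n → Matrix (Fin k) (Fin k) ℂ) :
    polyEvalM A 1 = 1 := by
  rw [MonoidAlgebra.one_def, polyEvalM_single]
  simp [wordEvalM]

lemma wordEvalM_reverse {n k : ℕ} (A : Fin n → Matrix (Fin k) (Fin k) ℂ)
    (hA : ∀ i, (A i).IsHermitian) (w : Word n) :
    wordEvalM A (FreeMonoid.ofList (FreeMonoid.toList w).reverse) = (wordEvalM A w)ᴴ := by
  simp only [wordEvalM, FreeMonoid.toList_ofList]
  rw [Matrix.conjTranspose_list_prod, List.map_map, List.map_reverse]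
  congr 2
  apply List.map_congr_left
  intro i _
  exact (hA i).eq.symm

lemma polyEvalM_ncStar {n k : ℕ} (A : Fin n → Matrix (Fin k) (Fin k) ℂ)
    (hA : ∀ i, (A i).IsHermitian) (f : NCPoly n) :
    polyEvalM A (ncStar f) = (polyEvalM A f)ᴴ := by
  induction f using MonoidAlgebra.induction_linear with
  | zero => rw [ncStar_zero]; simp [evalL_apply]
  | add f g hf hg =>
    rw [ncStar_add]
    simp only [evalL_apply, map_add, Matrix.conjTranspose_add] at *
    rw [hf, hg]
  | single w c =>
    rw [ncStar_single, polyEvalM_single, polyEvalM_single, wordEvalM_reverse A hA,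
      Matrix.conjTranspose_smul]
    rfl

lemma exists_coeffs {n d : ℕ} {f : NCPoly n} (hf : f ∈ degLE n d) :
    ∃ m : WordLE n d → ℂ, f = ∑ w, m w • mono w.1 := by
  have hs : {p : NCPoly n | ∃ w : Word n, wlen w ≤ d ∧ p = mono w}
      = Set.range (fun w : WordLE n d => mono w.1) := by
    ext p
    constructor
    · rintro ⟨w, hw, rfl⟩
      exact ⟨⟨w, hw⟩, rfl⟩
    · rintro ⟨w, rfl⟩
      exact ⟨w.1, w.2, rfl⟩
  rw [degLE, hs, Submodule.mem_span_range_iff_exists_fun] at hf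
  obtain ⟨m, hm⟩ := hf
  exact ⟨m, hm.symm⟩

/-- Schur complement type inequality. -/
lemma schur {ι : Type*} [Fintype ι] {k : ℕ} (b E : ι → Matrix (Fin k) (Fin k) ℂ)
    (hT : IsUnit (∑ v, b v * (b v)ᴴ)) :
    (∑ v, (E v)ᴴ * E v - (∑ v, b v * E v)ᴴ * (∑ v, b v * (b v)ᴴ)⁻¹ *
      (∑ v, b v * E v)).PosSemidef := by
  set T := ∑ v, b v * (b v)ᴴ with hTdef
  set F := ∑ v, b v * E v with hF
  have hTH : Tᴴ = T := by
    simp [hTdef, Matrix.conjTranspose_sum]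
  have hTiH : (T⁻¹)ᴴ = T⁻¹ := by rw [Matrix.conjTranspose_nonsing_inv, hTH]
  have hdet : IsUnit T.det := (Matrix.isUnit_iff_isUnit_det _).1 hT
  have key : ∑ v, (E v)ᴴ * E v - Fᴴ * T⁻¹ * F =
      ∑ v, (E v - (b v)ᴴ * T⁻¹ * F)ᴴ * (E v - (b v)ᴴ * T⁻¹ * F) := by
    have h1 : ∀ v, (E v - (b v)ᴴ * T⁻¹ * F)ᴴ * (E v - (b v)ᴴ * T⁻¹ * F) =
        (E v)ᴴ * E v - ((b v * E v)ᴴ * (T⁻¹ * F)) - (Fᴴ * T⁻¹) * (b v * E v)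
          + (Fᴴ * T⁻¹) * (b v * (b v)ᴴ) * (T⁻¹ * F) := by
      intro v
      simp only [Matrix.conjTranspose_sub, Matrix.conjTranspose_mul, hTiH,
        Matrix.conjTranspose_conjTranspose]
      noncomm_ring
    simp only [h1, Finset.sum_add_distrib, Finset.sum_sub_distrib, ← Finset.mul_sum,
      ← Finset.sum_mul, ← Matrix.conjTranspose_sum]
    rw [← hTdef, ← hF]
    have h2 : Fᴴ * T⁻¹ * T * (T⁻¹ * F) = Fᴴ * T⁻¹ * F := by
      rw [Matrix.nonsing_inv_mul_cancel_right _ _ hdet, Matrix.mul_assoc]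
    rw [h2, Matrix.mul_assoc]
    abel
  rw [key]
  exact Matrix.posSemidef_sum _ fun v _ => Matrix.posSemidef_conjTranspose_mul_self _

open scoped MatrixOrder in
lemma exists_root {k : ℕ} {K : Matrix (Fin k) (Fin k) ℂ} (hK : K.PosSemidef) :
    ∃ B : Matrix (Fin k) (Fin k) ℂ, K = Bᴴ * B :=
  CStarAlgebra.nonneg_iff_eq_star_mul_self.mp hK.nonneg

/-- Change of basis between monomials and orthonormal polynomials. -/
lemma exists_basis_change {n d : ℕ} (τ : NCPoly n →ₗ[ℂ] ℂ)
    (P : Word n → NCPoly n) (hONB : IsONB τ d P) :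
    ∃ M N : Matrix (WordLE n d) (WordLE n d) ℂ,
      M * N = 1 ∧ ∀ w : WordLE n d, mono w.1 = ∑ v, N w v • P v.1 := by
  classical
  obtain ⟨hmem, -, horth, -, -⟩ := hONB
  choose M hM using fun v : WordLE n d => exists_coeffs (hmem v.1 v.2)
  let N : Matrix (WordLE n d) (WordLE n d) ℂ := fun w u => τ (ncStar (P u.1) * mono w.1)
  have hMN : Matrix.of M * N = 1 := by
    ext v u
    have h := horth u.1 v.1 u.2 v.2
    rw [hM v, Finset.mul_sum, map_sum] at h
    simp only [Algebra.mul_smul_comm, map_smul, smul_eq_mul] at h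
    rw [Matrix.mul_apply, Matrix.one_apply]
    simp only [Matrix.of_apply, N]
    rw [h]
    simp only [Subtype.ext_iff, eq_comm]
  refine ⟨Matrix.of M, N, hMN, fun w => ?_⟩
  have hNM : N * Matrix.of M = 1 := mul_eq_one_comm.1 hMN
  have : ∀ v : WordLE n d, N w v • P v.1 = ∑ u, (N w v * M v u) • mono u.1 := by
    intro v
    rw [hM v, Finset.smul_sum]
    simp only [smul_smul]
  simp only [this]
  rw [Finset.sum_comm]
  have h2 : ∀ u : WordLE n d, ∑ v, N w v * M v u = if w = u then 1 else 0 := by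
    intro u
    rw [← Matrix.one_apply, ← hNM, Matrix.mul_apply]
    rfl
  simp only [← Finset.sum_smul, h2]
  simp

lemma expand_star {n d : ℕ} (τ : NCPoly n →ₗ[ℂ] ℂ)
    (P : Word n → NCPoly n) (hONB : IsONB τ d P) {f : NCPoly n} (hf : f ∈ degLE n d) :
    f = ∑ v : WordLE n d, τ (ncStar (P v.1) * f) • P v.1 := by
  classical
  obtain ⟨M, N, -, hN⟩ := exists_basis_change τ P hONB
  obtain ⟨m, hm⟩ := exists_coeffs hf
  have h1 : f = ∑ v : WordLE n d, (∑ w, m w * N w v) • P v.1 := by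
    rw [hm]
    simp only [hN, Finset.smul_sum, smul_smul, Finset.sum_smul]
    rw [Finset.sum_comm]
  conv_lhs => rw [h1]
  refine Finset.sum_congr rfl fun v _ => ?_
  congr 1
  conv_rhs => rw [h1, Finset.mul_sum, map_sum]
  have : ∀ u : WordLE n d, τ (ncStar (P v.1) * ((∑ w, m w * N w u) • P u.1)) =
      if v = u then (∑ w, m w * N w u) else 0 := by
    intro u
    rw [Algebra.mul_smul_comm, map_smul, hONB.2.2.1 v.1 u.1 v.2 u.2]
    simp [Subtype.ext_iff]
  simp only [this]
  simp

lemma cdKernel_eq {n d k : ℕ} (τ : NCPoly n →ₗ[ℂ] ℂ) (htr : IsTracial τ)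
    (P : Word n → NCPoly n) (hONB : IsONB τ d P)
    (A : Fin n → Matrix (Fin k) (Fin k) ℂ) (hA : ∀ i, (A i).IsHermitian) :
    cdKernel d P A = ∑ v : WordLE n d, (polyEvalM A (P v.1))ᴴ * polyEvalM A (P v.1) := by
  have h : ∀ w : WordLE n d, polyEvalM A (ncStar (P w.1)) =
      ∑ v : WordLE n d, τ (ncStar (P v.1) * ncStar (P w.1)) • polyEvalM A (P v.1) := by
    intro w
    have := congrArg (evalL A) (expand_star τ P hONB (ncStar_mem (hONB.1 w.1 w.2)))
    rw [map_sum] at this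
    simp only [map_smul] at this
    exact this
  unfold cdKernel
  simp only [← polyEvalM_ncStar A hA]
  simp only [h, Finset.mul_sum, Finset.sum_mul, Matrix.mul_smul, Matrix.smul_mul]
  rw [Finset.sum_comm]
  refine Finset.sum_congr rfl fun v _ => Finset.sum_congr rfl fun w _ => ?_
  rw [htr]

lemma evalId_eq {n d k : ℕ} (P : Word n → NCPoly n)
    (A : Fin n → Matrix (Fin k) (Fin k) ℂ) (N : Matrix (WordLE n d) (WordLE n d) ℂ)
    (hN : ∀ w : WordLE n d, mono w.1 = ∑ v, N w v • P v.1)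
    (c : WordLE n d → Matrix (Fin k) (Fin k) ℂ) :
    evalId A c (fun w : WordLE n d => mono w.1) =
      ∑ v, (∑ w, N w v • c w) * polyEvalM A (P v.1) := by
  unfold evalId
  simp only [hN, evalL_apply, map_sum, map_smul, Finset.mul_sum, Finset.sum_mul,
    Matrix.mul_smul, Matrix.smul_mul]
  rw [Finset.sum_comm]

lemma idTensorTau_eq {n d k : ℕ} (τ : NCPoly n →ₗ[ℂ] ℂ) (htr : IsTracial τ)
    (P : Word n → NCPoly n) (hONB : IsONB τ d P) (N : Matrix (WordLE n d) (WordLE n d) ℂ)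
    (hN : ∀ w : WordLE n d, mono w.1 = ∑ v, N w v • P v.1)
    (c : WordLE n d → Matrix (Fin k) (Fin k) ℂ) :
    idTensorTau τ c (fun w : WordLE n d => mono w.1) =
      ∑ v, (∑ w, N w v • c w) * (∑ w, N w v • c w)ᴴ := by
  classical
  have h : ∀ w u : WordLE n d, τ (mono w.1 * ncStar (mono u.1)) =
      ∑ v, N w v * star (N u v) := by
    intro w u
    rw [htr, hN w, hN u, ncStar_sum]
    simp only [ncStar_smul, Finset.sum_mul, Finset.mul_sum, map_sum, Algebra.mul_smul_comm,
      Algebra.smul_mul_assoc, map_smul]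
    have : ∀ x y : WordLE n d, τ (ncStar (P x.1) * P y.1) = if x = y then 1 else 0 := by
      intro x y
      rw [hONB.2.2.1 x.1 y.1 x.2 y.2]
      simp [Subtype.ext_iff]
    simp [this, mul_comm]
  have e : ∀ v : WordLE n d, (∑ w, N w v • c w) * (∑ w, N w v • c w)ᴴ =
      ∑ w, ∑ u, (N w v * star (N u v)) • (c w * (c u)ᴴ) := by
    intro v
    rw [Matrix.conjTranspose_sum, Finset.sum_mul_sum]
    refine Finset.sum_congr rfl fun w _ => Finset.sum_congr rfl fun u _ => ?_
    rw [Matrix.conjTranspose_smul, Matrix.smul_mul, Matrix.mul_smul, smul_smul]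
  unfold idTensorTau
  simp only [h, e, Finset.sum_smul]
  symm
  rw [Finset.sum_comm]
  refine Finset.sum_congr rfl fun w _ => ?_
  rw [Finset.sum_comm]

end helpers

/-- For every `P ∈ M_k(ℂ⟨X⟩_d)` with `(Id⊗τ)(PP⋆)` invertible one has
`P(A)(I_k)† ((Id⊗τ)(PP⋆))⁻¹ P(A)(I_k) ⪯ κ_{τ,d}(A,A)(I_k)`; consequently
`κ_{τ,d}(A,A)(I_k)` is the maximum, in the Loewner order, of
`{P(A)(I_k)† P(A)(I_k) : P ∈ M_k(ℂ⟨X⟩_d), (Id⊗τ)(PP⋆) = I_k}`. -/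
theorem cdKernel_max {n d k : ℕ} (hk : 1 ≤ k) (τ : NCPoly n →ₗ[ℂ] ℂ)
    (hpos : IsPositive τ) (htr : IsTracial τ) (hstate : τ 1 = 1) (hfaith : IsFaithful τ)
    (P : Word n → NCPoly n) (hONB : IsONB τ d P)
    (A : Fin n → Matrix (Fin k) (Fin k) ℂ) (hA : ∀ i, (A i).IsHermitian) :
    (∀ c : WordLE n d → Matrix (Fin k) (Fin k) ℂ,
      IsUnit (idTensorTau τ c (fun w : WordLE n d => mono w.1)) →
      (cdKernel d P A -
        (evalId A c (fun w : WordLE n d => mono w.1))ᴴ *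
          (idTensorTau τ c (fun w : WordLE n d => mono w.1))⁻¹ *
          evalId A c (fun w : WordLE n d => mono w.1)).PosSemidef) ∧
    (∀ c : WordLE n d → Matrix (Fin k) (Fin k) ℂ,
      idTensorTau τ c (fun w : WordLE n d => mono w.1) = 1 →
      (cdKernel d P A -
        (evalId A c (fun w : WordLE n d => mono w.1))ᴴ *
          evalId A c (fun w : WordLE n d => mono w.1)).PosSemidef) ∧
    (∃ c : WordLE n d → Matrix (Fin k) (Fin k) ℂ,
      idTensorTau τ c (fun w : WordLE n d => mono w.1) = 1 ∧
      (evalId A c (fun w : WordLE n d => mono w.1))ᴴ *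
          evalId A c (fun w : WordLE n d => mono w.1) = cdKernel d P A) := by
  classical
  obtain ⟨M, N, hMN, hN⟩ := exists_basis_change τ P hONB
  have part1 : ∀ c : WordLE n d → Matrix (Fin k) (Fin k) ℂ,
      IsUnit (idTensorTau τ c (fun w : WordLE n d => mono w.1)) →
      (cdKernel d P A -
        (evalId A c (fun w : WordLE n d => mono w.1))ᴴ *
          (idTensorTau τ c (fun w : WordLE n d => mono w.1))⁻¹ *
          evalId A c (fun w : WordLE n d => mono w.1)).PosSemidef := by
    intro c hc
    rw [idTensorTau_eq τ htr P hONB N hN] at hc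
    rw [cdKernel_eq τ htr P hONB A hA, idTensorTau_eq τ htr P hONB N hN,
      evalId_eq P A N hN]
    exact schur _ _ hc
  refine ⟨part1, ?_, ?_⟩
  · intro c hc
    have := part1 c (by rw [hc]; exact isUnit_one)
    rwa [hc, inv_one, Matrix.mul_one] at this
  · have hKeq := cdKernel_eq τ htr P hONB A hA
    set K := cdKernel d P A with hK
    have hpsd : ∀ s : Finset (WordLE n d),
        (∑ v ∈ s, (polyEvalM A (P v.1))ᴴ * polyEvalM A (P v.1)).PosSemidef := fun s =>
      Matrix.posSemidef_sum _ fun v _ => Matrix.posSemidef_conjTranspose_mul_self _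
    have hKpd : K.PosDef := by
      rw [hKeq, ← Finset.add_sum_erase Finset.univ _
        (Finset.mem_univ (⟨1, by simp [wlen]⟩ : WordLE n d))]
      simp only [hONB.2.1, polyEvalM_one, Matrix.conjTranspose_one, Matrix.mul_one]
      exact Matrix.PosDef.one.add_posSemidef (hpsd _)
    obtain ⟨B, hB⟩ := exists_root hKpd.posSemidef
    have hBdet : IsUnit B.det := by
      have h := (Matrix.isUnit_iff_isUnit_det _).1 hKpd.isUnit
      rw [hB, Matrix.det_mul] at h
      exact isUnit_of_mul_isUnit_right h
    have hBHdet : IsUnit (Bᴴ).det := by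
      have h := (Matrix.isUnit_iff_isUnit_det _).1 hKpd.isUnit
      rw [hB, Matrix.det_mul] at h
      exact isUnit_of_mul_isUnit_left h
    let b : WordLE n d → Matrix (Fin k) (Fin k) ℂ :=
      fun v => (Bᴴ)⁻¹ * (polyEvalM A (P v.1))ᴴ
    let c : WordLE n d → Matrix (Fin k) (Fin k) ℂ := fun w => ∑ v, M v w • b v
    have hc : ∀ v, ∑ w, N w v • c w = b v := by
      intro v
      simp only [c, Finset.smul_sum, smul_smul]
      rw [Finset.sum_comm]
      have h2 : ∀ u, ∑ w, N w v * M u w = if u = v then 1 else 0 := by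
        intro u
        rw [← Matrix.one_apply, ← hMN, Matrix.mul_apply]
        exact Finset.sum_congr rfl fun _ _ => mul_comm _ _
      simp only [← Finset.sum_smul, h2]
      simp
    have hF : evalId A c (fun w : WordLE n d => mono w.1) = B := by
      rw [evalId_eq P A N hN]
      simp only [hc, b, Matrix.mul_assoc]
      rw [← Finset.mul_sum, ← hKeq, hB, Matrix.nonsing_inv_mul_cancel_left _ _ hBHdet]
    refine ⟨c, ?_, ?_⟩
    · rw [idTensorTau_eq τ htr P hONB N hN]
      simp only [hc, b, Matrix.conjTranspose_mul, Matrix.conjTranspose_conjTranspose,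
        Matrix.conjTranspose_nonsing_inv]
      have : ∀ v : WordLE n d, (Bᴴ)⁻¹ * (polyEvalM A (P v.1))ᴴ * (polyEvalM A (P v.1) * B⁻¹) =
          (Bᴴ)⁻¹ * ((polyEvalM A (P v.1))ᴴ * polyEvalM A (P v.1)) * B⁻¹ := by
        intro v; simp only [Matrix.mul_assoc]
      simp only [this]
      rw [← Finset.sum_mul, ← Finset.mul_sum, ← hKeq, hB,
        Matrix.nonsing_inv_mul_cancel_left _ _ hBHdet, Matrix.mul_nonsing_inv _ hBdet]
    · rw [hF, hB]

end NCCD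
end

section
/- In the C*-setting, let u = (u_{jl}) ∈ GL_n(ℝ) be an invertible real n×n matrix, and set b_j := Σ_{l=1}^n u_{jl} a_l (a tuple b = (b_1,…,b_n) of selfadjoint elements of 𝒜) and, for A ∈ M_k(ℂ)^n, (uA)_j := Σ_{l=1}^n u_{jl} A_l. Then for every d ∈ ℕ, every k ≥ 1, every A ∈ M_k(ℂ)^n, and both • = 2 and • = ∞: Φ^•_{a,d}(A) = Φ^•_{b,d}(uA). -/
open scoped ComplexOrder Matrix

open scoped Matrix.Norms.L2Operator

namespace NCCD

section CStar

variable {𝒜 : Type*} [NormedRing 𝒜] [StarRing 𝒜] [CStarRing 𝒜] [CompleteSpace 𝒜]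
  [NormedAlgebra ℂ 𝒜] [StarModule ℂ 𝒜]

/-- `tr` is a tracial state on the unital C*-algebra `𝒜`: a positive linear functional with
`tr 1 = 1` and `tr (xy) = tr (yx)`. -/
def IsTracialStateA (tr : 𝒜 →ₗ[ℂ] ℂ) : Prop :=
  tr 1 = 1 ∧ (∀ x : 𝒜, 0 ≤ tr (star x * x)) ∧ (∀ x y : 𝒜, tr (x * y) = tr (y * x))

/-- `tr` is faithful: `tr (x⋆x) = 0` implies `x = 0`. -/
def IsFaithfulA (tr : 𝒜 →ₗ[ℂ] ℂ) : Prop :=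
  ∀ x : 𝒜, tr (star x * x) = 0 → x = 0

/-- Evaluation `a^w` of a word at a tuple of elements of `𝒜`. -/
def wordEvalA {N : ℕ} (a : Fin N → 𝒜) (w : Word N) : 𝒜 :=
  ((FreeMonoid.toList w).map a).prod

/-- Evaluation `f(a)` of a scalar noncommutative polynomial at a tuple of elements of `𝒜`. -/
noncomputable def polyEvalA {N : ℕ} (a : Fin N → 𝒜) (f : NCPoly N) : 𝒜 :=
  Finsupp.sum f.coeff fun w z => z • wordEvalA a w

/-- Evaluation `P(a) = Σ_w c_w ⊗ a^w ∈ M_k(𝒜)` of the matrix noncommutative polynomial with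
coefficients `e : ⟨X⟩_d → M_k(ℂ)`. -/
noncomputable def matPolyEvalA {N d k : ℕ} (a : Fin N → 𝒜)
    (e : WordLE N d → Matrix (Fin k) (Fin k) ℂ) : Matrix (Fin k) (Fin k) 𝒜 :=
  ∑ w : WordLE N d, (e w).map (fun z => z • wordEvalA a w.1)

/-- `P(A)(I_k) = Σ_w c_w A^w` for the matrix noncommutative polynomial with coefficients
`e : ⟨X⟩_d → M_k(ℂ)`. -/
noncomputable def matPolyEvalM {N d k : ℕ} (A : Fin N → Matrix (Fin k) (Fin k) ℂ)
    (e : WordLE N d → Matrix (Fin k) (Fin k) ℂ) : Matrix (Fin k) (Fin k) ℂ :=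
  ∑ w : WordLE N d, e w * wordEvalM A w.1

/-- The statement `‖P‖² ≤ c` for `P ∈ M_k(𝒜)`, `𝒜` a unital C*-algebra. It is encoded --
equivalently, since `M_k(𝒜)` is again a unital C*-algebra, in which an element is positive if
and only if it is of the form `Q⋆Q`, and `‖P‖² ≤ c` if and only if `c·1 - P⋆P` is positive --
by the existence of `Q ∈ M_k(𝒜)` with `c·1 - Pᴴ P = Qᴴ Q`. -/
def cstarNormSqLE {k : ℕ} (P : Matrix (Fin k) (Fin k) 𝒜) (c : ℝ) : Prop :=
  ∃ Q : Matrix (Fin k) (Fin k) 𝒜, (c : ℂ) • (1 : Matrix (Fin k) (Fin k) 𝒜) - Pᴴ * P = Qᴴ * Q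

/-- The degree-`d` noncommutative Siciak function `Φ²_{a,d}`:
`Φ²_{a,d}(A) = sup { tr_k(P(A)(I_k)† P(A)(I_k)) : P ∈ M_k(ℂ⟨X⟩_d), ‖P(a)‖ ≤ 1 }`. -/
noncomputable def Phi2 {N : ℕ} (a : Fin N → 𝒜) (d k : ℕ)
    (A : Fin N → Matrix (Fin k) (Fin k) ℂ) : ℝ :=
  sSup { t : ℝ | ∃ e : WordLE N d → Matrix (Fin k) (Fin k) ℂ,
    cstarNormSqLE (matPolyEvalA a e) 1 ∧
    t = (Matrix.trace ((matPolyEvalM A e)ᴴ * matPolyEvalM A e)).re / k }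

/-- The degree-`d` noncommutative Siciak function `Φ^∞_{a,d}`:
`Φ^∞_{a,d}(A) = sup { ‖P(A)(I_k)‖² : P ∈ M_k(ℂ⟨X⟩_d), ‖P(a)‖ ≤ 1 }`, the norm on `M_k(ℂ)`
being the operator (C*) norm. -/
noncomputable def PhiInf {N : ℕ} (a : Fin N → 𝒜) (d k : ℕ)
    (A : Fin N → Matrix (Fin k) (Fin k) ℂ) : ℝ :=
  sSup { t : ℝ | ∃ e : WordLE N d → Matrix (Fin k) (Fin k) ℂ,
    cstarNormSqLE (matPolyEvalA a e) 1 ∧ t = ‖matPolyEvalM A e‖ ^ 2 }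

end CStar

end NCCD

namespace NCCD

theorem wordSubst_mem_span {B : Type*} [Ring B] [Algebra ℂ B] {n : ℕ}
    (c : Fin n → Fin n → ℂ) (x : Fin n → B) (w : List (Fin n)) :
    (w.map (fun j => ∑ l, c j l • x l)).prod ∈
      Submodule.span ℂ {p : B | ∃ v : List (Fin n), v.length = w.length ∧ p = (v.map x).prod} := by
  induction w with
  | nil => exact Submodule.subset_span ⟨[], rfl, by simp⟩
  | cons j w ih =>
    rw [List.map_cons, List.prod_cons, Finset.sum_mul]
    refine Submodule.sum_mem _ fun l _ => ?_
    rw [smul_mul_assoc]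
    refine Submodule.smul_mem _ _ ?_
    generalize (w.map (fun j => ∑ l, c j l • x l)).prod = q at ih
    induction ih using Submodule.span_induction with
    | mem y hy =>
      obtain ⟨v, hv, rfl⟩ := hy
      exact Submodule.subset_span ⟨l :: v, by simp [hv], by simp⟩
    | zero => simp
    | add y z _ _ hy hz => rw [mul_add]; exact Submodule.add_mem _ hy hz
    | smul r y _ hy => rw [mul_smul_comm]; exact Submodule.smul_mem _ _ hy

/-- Common substitution coefficients for two algebras. -/
theorem exists_subst_coeff {B C : Type*} [Ring B] [Algebra ℂ B] [Ring C] [Algebra ℂ C] {n : ℕ}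
    (d : ℕ) (c : Fin n → Fin n → ℂ) (x : Fin n → B) (y : Fin n → C) (w : WordLE n d) :
    ∃ g : WordLE n d → ℂ,
      ((FreeMonoid.toList w.1).map (fun j => ∑ l, c j l • x l)).prod =
        ∑ v : WordLE n d, g v • ((FreeMonoid.toList v.1).map x).prod ∧
      ((FreeMonoid.toList w.1).map (fun j => ∑ l, c j l • y l)).prod =
        ∑ v : WordLE n d, g v • ((FreeMonoid.toList v.1).map y).prod := by
  let z : Fin n → B × C := fun i => (x i, y i)
  have h := wordSubst_mem_span c z (FreeMonoid.toList w.1)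
  have h2 : ((FreeMonoid.toList w.1).map (fun j => ∑ l, c j l • z l)).prod ∈
      Submodule.span ℂ (Set.range fun v : WordLE n d => ((FreeMonoid.toList v.1).map z).prod) := by
    refine Submodule.span_mono ?_ h
    rintro p ⟨v, hv, rfl⟩
    exact ⟨⟨FreeMonoid.ofList v, by
      have := w.2
      simp only [wlen, FreeMonoid.toList_ofList] at this ⊢
      omega⟩, rfl⟩
  obtain ⟨g, hg⟩ := (Submodule.mem_span_range_iff_exists_fun ℂ).1 h2
  refine ⟨g, ?_, ?_⟩
  · have := congrArg (AlgHom.fst ℂ B C) hg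
    simp only [map_sum, map_smul, map_list_prod, List.map_map, Function.comp_def,
      AlgHom.fst_apply, Prod.smul_fst, Prod.fst_sum, z] at this
    exact this.symm
  · have := congrArg (AlgHom.snd ℂ B C) hg
    simp only [map_sum, map_smul, map_list_prod, List.map_map, Function.comp_def,
      AlgHom.snd_apply, Prod.smul_snd, Prod.snd_sum, z] at this
    exact this.symm

theorem exists_subst {𝒜 : Type*} [NormedRing 𝒜] [NormedAlgebra ℂ 𝒜]
    {n d k : ℕ} (c : Fin n → Fin n → ℂ) (a : Fin n → 𝒜) (A : Fin n → Matrix (Fin k) (Fin k) ℂ)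
    (e : WordLE n d → Matrix (Fin k) (Fin k) ℂ) :
    ∃ e' : WordLE n d → Matrix (Fin k) (Fin k) ℂ,
      matPolyEvalA a e' = matPolyEvalA (fun j => ∑ l, c j l • a l) e ∧
      matPolyEvalM A e' = matPolyEvalM (fun j => ∑ l, c j l • A l) e := by
  choose g hg1 hg2 using exists_subst_coeff d c a A
  refine ⟨fun v => ∑ w, g w v • e w, ?_, ?_⟩
  · ext i j
    simp only [matPolyEvalA, Matrix.sum_apply, Matrix.map_apply, wordEvalA, hg1,
      Matrix.smul_apply, Finset.sum_smul, Finset.smul_sum, smul_smul, smul_eq_mul]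
    rw [Finset.sum_comm]
    simp only [mul_comm]
  · simp only [matPolyEvalM, wordEvalM, hg2, Finset.sum_mul, Finset.mul_sum]
    rw [Finset.sum_comm]
    simp only [smul_mul_assoc, mul_smul_comm]

theorem lin_inv {B : Type*} [AddCommGroup B] [Module ℂ B] {n : ℕ}
    (u v : Matrix (Fin n) (Fin n) ℝ) (h : v * u = 1) (x : Fin n → B) :
    (fun j => ∑ l, (v j l : ℂ) • ∑ m, (u l m : ℂ) • x m) = x := by
  funext j
  simp only [Finset.smul_sum, smul_smul]
  rw [Finset.sum_comm]
  simp only [← Finset.sum_smul]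
  have key : ∀ m, ∑ l, (v j l : ℂ) * (u l m : ℂ) = if j = m then 1 else 0 := by
    intro m
    have := congrFun (congrFun h j) m
    rw [Matrix.mul_apply, Matrix.one_apply] at this
    have h3 := congrArg (fun r : ℝ => (r : ℂ)) this
    push_cast at h3
    rw [h3]
    split_ifs <;> simp
  simp [key]

/-- Invariance of the degree-`d` noncommutative Siciak functions under an
invertible real linear change of coordinates: with `b := u·a` and `(uA)_j := Σ_l u_{jl} A_l`,
one has `Φ^•_{a,d}(A) = Φ^•_{b,d}(uA)` for `• ∈ {2, ∞}`. -/
theorem phi_linear_change_of_coordinates {𝒜 : Type*} [NormedRing 𝒜] [StarRing 𝒜] [CStarRing 𝒜]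
    [CompleteSpace 𝒜] [NormedAlgebra ℂ 𝒜] [StarModule ℂ 𝒜]
    (tr : 𝒜 →ₗ[ℂ] ℂ) (htr : IsTracialStateA tr) (hfaith : IsFaithfulA tr)
    {n : ℕ} (a : Fin n → 𝒜) (ha : ∀ i, IsSelfAdjoint (a i))
    (u : Matrix (Fin n) (Fin n) ℝ) (hu : IsUnit u)
    (d k : ℕ) (hk : 1 ≤ k) (A : Fin n → Matrix (Fin k) (Fin k) ℂ) :
    Phi2 a d k A =
      Phi2 (fun j => ∑ l, (u j l : ℂ) • a l) d k (fun j => ∑ l, (u j l : ℂ) • A l) ∧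
    PhiInf a d k A =
      PhiInf (fun j => ∑ l, (u j l : ℂ) • a l) d k (fun j => ∑ l, (u j l : ℂ) • A l) := by
  obtain ⟨v, hv⟩ : ∃ v, v * u = 1 := hu.exists_left_inv
  have fwd : ∀ e : WordLE n d → Matrix (Fin k) (Fin k) ℂ,
      ∃ e' : WordLE n d → Matrix (Fin k) (Fin k) ℂ,
        matPolyEvalA (fun j => ∑ l, (u j l : ℂ) • a l) e' = matPolyEvalA a e ∧
        matPolyEvalM (fun j => ∑ l, (u j l : ℂ) • A l) e' = matPolyEvalM A e := by
    intro e
    have := exists_subst (fun j l => (v j l : ℂ)) (fun j => ∑ l, (u j l : ℂ) • a l)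
      (fun j => ∑ l, (u j l : ℂ) • A l) e
    rwa [lin_inv u v hv a, lin_inv u v hv A] at this
  have bwd := exists_subst (d := d) (fun j l => (u j l : ℂ)) a A
  constructor
  · unfold Phi2
    congr 1
    ext t
    constructor
    · rintro ⟨e, he, rfl⟩
      obtain ⟨e', h1, h2⟩ := fwd e
      exact ⟨e', by rw [h1]; exact he, by rw [h2]⟩
    · rintro ⟨e, he, rfl⟩
      obtain ⟨e', h1, h2⟩ := bwd e
      exact ⟨e', by rw [h1]; exact he, by rw [h2]⟩
  · unfold PhiInf
    congr 1
    ext t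
    constructor
    · rintro ⟨e, he, rfl⟩
      obtain ⟨e', h1, h2⟩ := fwd e
      exact ⟨e', by rw [h1]; exact he, by rw [h2]⟩
    · rintro ⟨e, he, rfl⟩
      obtain ⟨e', h1, h2⟩ := bwd e
      exact ⟨e', by rw [h1]; exact he, by rw [h2]⟩

end NCCD
end
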